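/- Let f ∈ W^{1,p}(ℝ^d) and g ∈ L^q(ℝ^d) with 1 ≤ p, q ≤ ∞ and 1/p + 1/q ≤ 1, and let 1/r = 1/p + 1/q. Let η ∈ C_c^∞(ℝ^d) be a standard mollifier supported in B(0,1) and η_ε(x) = ε^{−d}η(x/ε). Then there exists a constant C ≥ 0 independent of ε, f and g such that ‖div(fg) * η_ε − div(f (g * η_ε))‖_{L^r(ℝ^d)} ≤ C ‖f‖_{W^{1,p}(ℝ^d)} ‖g‖_{L^q(ℝ^d)}. -/

import Mathlib

open MeasureTheory Metric Set Filter
open scoped ENNReal Topology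

noncomputable section

abbrev Euc (d : ℕ) := EuclideanSpace ℝ (Fin d)

/-- `i`-th standard basis vector of `ℝ^d`. -/
def e (d : ℕ) (i : Fin d) : Euc d := EuclideanSpace.single i 1

/-- A standard mollifier: smooth, nonnegative, unit mass, supported in the unit ball. -/
def IsStdMollifier {d : ℕ} (η : Euc d → ℝ) : Prop :=
  ContDiff ℝ (⊤ : ℕ∞) η ∧ (∀ x, 0 ≤ η x) ∧ (∫ x, η x) = 1 ∧ tsupport η ⊆ closedBall 0 1

/-- The rescaled mollifier `η_ε(x) = ε^{-d} η(x/ε)`. -/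
def mollScaled {d : ℕ} (η : Euc d → ℝ) (ε : ℝ) (x : Euc d) : ℝ :=
  (ε ^ d)⁻¹ * η (ε⁻¹ • x)

/-- Mollification `f * η_ε`. -/
def moll {d : ℕ} {F : Type*} [NormedAddCommGroup F] [NormedSpace ℝ F]
    (η : Euc d → ℝ) (ε : ℝ) (f : Euc d → F) (x : Euc d) : F :=
  ∫ y, mollScaled η ε (x - y) • f y

/-- Minkowski's integral inequality over a finite measure, in supremum form. -/
theorem eLpNorm_lintegral_le_measure_mul {α Ω : Type*} [MeasurableSpace α] [MeasurableSpace Ω]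
    {ν : Measure α} [SFinite ν] {μ : Measure Ω} [IsFiniteMeasure μ] {r : ℝ≥0∞} (hr : 1 ≤ r)
    {F : α → Ω → ℝ≥0∞} (hF : Measurable (Function.uncurry F)) {K : ℝ≥0∞}
    (hK : ∀ ω, eLpNorm (fun x => F x ω) r ν ≤ K) :
    eLpNorm (fun x => ∫⁻ ω, F x ω ∂μ) r ν ≤ μ univ * K := by
  rcases eq_or_ne r ∞ with rfl | hr_top
  · rw [eLpNorm_exponent_top]
    apply eLpNormEssSup_le_of_ae_enorm_bound
    have h : ∀ᵐ x ∂ν, ∀ᵐ ω ∂μ, F x ω ≤ K := by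
      refine (Measure.ae_ae_comm (p := fun x ω => F x ω ≤ K)
        (measurableSet_le hF measurable_const)).2 ?_
      refine .of_forall fun ω => ?_
      have hω := hK ω
      rw [eLpNorm_exponent_top] at hω
      filter_upwards [enorm_ae_le_eLpNormEssSup (fun x => F x ω) ν] with x hx
      exact hx.trans hω
    filter_upwards [h] with x hx
    calc ‖∫⁻ ω, F x ω ∂μ‖ₑ = ∫⁻ ω, F x ω ∂μ := rfl
      _ ≤ ∫⁻ _, K ∂μ := lintegral_mono_ae hx
      _ = μ univ * K := by rw [lintegral_const, mul_comm]
  · have hr0 : r ≠ 0 := (zero_lt_one.trans_le hr).ne'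
    have hs : 1 ≤ r.toReal := by
      simpa using ENNReal.toReal_mono hr_top hr
    have hs0 : 0 < r.toReal := zero_lt_one.trans_le hs
    set s := r.toReal with hs_def
    have jensen : ∀ x, (∫⁻ ω, F x ω ∂μ) ^ s ≤ (∫⁻ ω, F x ω ^ s ∂μ) * μ univ ^ (s - 1) := by
      intro x
      have hm : Measurable (F x) := hF.comp measurable_prodMk_left
      have h := eLpNorm_le_eLpNorm_mul_rpow_measure_univ (μ := μ) hr
        hm.aestronglyMeasurable
      rw [eLpNorm_one_eq_lintegral_enorm, eLpNorm_eq_lintegral_rpow_enorm_toReal hr0 hr_top,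
        ← hs_def] at h
      simp only [enorm_eq_self, ENNReal.toReal_one] at h
      calc (∫⁻ ω, F x ω ∂μ) ^ s
          ≤ ((∫⁻ ω, F x ω ^ s ∂μ) ^ (1 / s) * μ univ ^ (1 / 1 - 1 / s)) ^ s := by gcongr
        _ = _ := by
          rw [ENNReal.mul_rpow_of_nonneg _ _ hs0.le, ← ENNReal.rpow_mul, ← ENNReal.rpow_mul]
          congr 2
          · field_simp; simp
          · field_simp
    have hint : ∀ ω, ∫⁻ x, F x ω ^ s ∂ν ≤ K ^ s := by
      intro ω
      have h := hK ω
      rw [eLpNorm_eq_lintegral_rpow_enorm_toReal hr0 hr_top, ← hs_def, one_div,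
        ENNReal.rpow_inv_le_iff hs0] at h
      simpa using h
    rw [eLpNorm_eq_lintegral_rpow_enorm_toReal hr0 hr_top, ← hs_def, one_div,
      ENNReal.rpow_inv_le_iff hs0]
    simp only [enorm_eq_self]
    calc ∫⁻ x, (∫⁻ ω, F x ω ∂μ) ^ s ∂ν
        ≤ ∫⁻ x, (∫⁻ ω, F x ω ^ s ∂μ) * μ univ ^ (s - 1) ∂ν := lintegral_mono jensen
      _ = (∫⁻ ω, ∫⁻ x, F x ω ^ s ∂ν ∂μ) * μ univ ^ (s - 1) := by
        rw [lintegral_mul_const' _ _ (ENNReal.rpow_ne_top_of_nonneg (by linarith)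
          (measure_ne_top _ _)), lintegral_lintegral_swap]
        exact (hF.pow_const s).aemeasurable
      _ ≤ (∫⁻ _, K ^ s ∂μ) * μ univ ^ (s - 1) := by gcongr with ω; exact hint ω
      _ = (μ univ * K) ^ s := by
        rw [lintegral_const, ENNReal.mul_rpow_of_nonneg _ _ hs0.le, mul_assoc, mul_comm]
        congr 1
        nth_rewrite 1 [← ENNReal.rpow_one (μ univ)]
        rw [← ENNReal.rpow_add_of_nonneg _ _ zero_le_one (by linarith)]
        congr 1; ring

/-- Mean value inequality along a segment, without continuity of the derivative. -/
theorem enorm_sub_le_lintegral_fderiv {E F : Type*} [NormedAddCommGroup E] [NormedSpace ℝ E]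
    [MeasurableSpace E] [BorelSpace E] [NormedAddCommGroup F] [NormedSpace ℝ F] [CompleteSpace F]
    {f : E → F} (hf : Differentiable ℝ f) (x w : E) :
    ‖f (x - w) - f x‖ₑ ≤ ‖w‖ₑ * ∫⁻ t in Icc (0 : ℝ) 1, ‖fderiv ℝ f (x - t • w)‖ₑ := by
  have hderiv : ∀ t : ℝ, HasDerivAt (fun t : ℝ => f (x - t • w))
      (fderiv ℝ f (x - t • w) (-w)) t := fun t => by
    have h1 : HasDerivAt (fun t : ℝ => x - t • w) (-w) t := by
      simpa using ((hasDerivAt_id t).smul_const w).const_sub x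
    exact (hf _).hasFDerivAt.comp_hasDerivAt t h1
  have hle : ∫⁻ t in Icc (0 : ℝ) 1, ‖fderiv ℝ f (x - t • w) (-w)‖ₑ
      ≤ ‖w‖ₑ * ∫⁻ t in Icc (0 : ℝ) 1, ‖fderiv ℝ f (x - t • w)‖ₑ := by
    rw [← lintegral_const_mul' _ _ enorm_ne_top]
    refine lintegral_mono fun t => ?_
    rw [mul_comm, ← enorm_neg w]
    exact ContinuousLinearMap.le_opENorm _ _
  refine le_trans ?_ hle
  by_cases htop : ∫⁻ t in Icc (0 : ℝ) 1, ‖fderiv ℝ f (x - t • w) (-w)‖ₑ = ∞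
  · exact htop ▸ le_top
  have hmeas : AEStronglyMeasurable (fun t : ℝ => fderiv ℝ f (x - t • w) (-w))
      (volume.restrict (Icc 0 1)) := by
    rw [show (fun t : ℝ => fderiv ℝ f (x - t • w) (-w)) = deriv fun t : ℝ => f (x - t • w) from
      funext fun t => (hderiv t).deriv.symm]
    exact (stronglyMeasurable_deriv _).aestronglyMeasurable
  have hint : IntegrableOn (fun t : ℝ => fderiv ℝ f (x - t • w) (-w)) (Icc 0 1) :=
    ⟨hmeas, lt_top_iff_ne_top.2 htop⟩
  have hftc := intervalIntegral.integral_eq_sub_of_hasDerivAt (a := 0) (b := 1)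
    (fun t _ => hderiv t)
    ((intervalIntegrable_iff_integrableOn_Icc_of_le zero_le_one).2 hint)
  rw [intervalIntegral.integral_of_le zero_le_one, ← integral_Icc_eq_integral_Ioc] at hftc
  simp only [one_smul, zero_smul, sub_zero] at hftc
  rw [← hftc]
  exact enorm_integral_le_lintegral_enorm _

/-- Hölder bound for a product averaged over independent translations. -/
theorem eLpNorm_lintegral_translate_mul_le {E F : Type*} [NormedAddCommGroup E] [NormedSpace ℝ E]
    [MeasurableSpace E] [BorelSpace E] [SecondCountableTopology E]
    [NormedAddCommGroup F] [NormedSpace ℝ F] {ν : Measure E} [SFinite ν]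
    [ν.IsAddHaarMeasure]
    {p q r : ℝ≥0∞} (hr1 : 1 ≤ r) (hr : r⁻¹ = p⁻¹ + q⁻¹) {g : E → ℝ} (hg : StronglyMeasurable g)
    {D : E → F} (hD : StronglyMeasurable D)
    (μ : Measure E) [IsFiniteMeasure μ] (τ : Measure ℝ) [IsFiniteMeasure τ] :
    eLpNorm (fun x => ∫⁻ w, ‖g (x - w)‖ₑ * ∫⁻ t, ‖D (x - t • w)‖ₑ ∂τ ∂μ) r ν
      ≤ μ univ * τ univ * (eLpNorm g q ν * eLpNorm D p ν) := by
  have hm : Measurable (Function.uncurry fun (x : E) (z : E × ℝ) =>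
      ‖g (x - z.1)‖ₑ * ‖D (x - z.2 • z.1)‖ₑ) := by
    refine Measurable.mul (f := fun y : E × E × ℝ => ‖g (y.1 - y.2.1)‖ₑ)
      (g := fun y : E × E × ℝ => ‖D (y.1 - y.2.2 • y.2.1)‖ₑ) ?_ ?_
    · exact (hg.comp_measurable (by fun_prop :
        Measurable fun y : E × E × ℝ => y.1 - y.2.1)).enorm
    · exact (hD.comp_measurable (by fun_prop :
        Measurable fun y : E × E × ℝ => y.1 - y.2.2 • y.2.1)).enorm
  have heq : (fun x => ∫⁻ w, ‖g (x - w)‖ₑ * ∫⁻ t, ‖D (x - t • w)‖ₑ ∂τ ∂μ)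
      = fun x => ∫⁻ z, ‖g (x - z.1)‖ₑ * ‖D (x - z.2 • z.1)‖ₑ ∂(μ.prod τ) := by
    funext x
    have hmx : Measurable fun z : E × ℝ => ‖g (x - z.1)‖ₑ * ‖D (x - z.2 • z.1)‖ₑ :=
      hm.comp measurable_prodMk_left
    rw [lintegral_prod _ hmx.aemeasurable]
    exact lintegral_congr fun w => (lintegral_const_mul' _ _ enorm_ne_top).symm
  rw [heq]
  refine (eLpNorm_lintegral_le_measure_mul hr1 hm (K := eLpNorm g q ν * eLpNorm D p ν)
    fun z => ?_).trans_eq ?_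
  · have : ENNReal.HolderTriple q p r := ⟨by rw [hr, add_comm]⟩
    have hg' := measurePreserving_sub_right ν z.1
    have hD' := measurePreserving_sub_right ν (z.2 • z.1)
    rw [← eLpNorm_comp_measurePreserving hg.aestronglyMeasurable hg',
      ← eLpNorm_comp_measurePreserving hD.aestronglyMeasurable hD']
    refine le_trans (le_of_eq ?_) (eLpNorm_smul_le_mul_eLpNorm (p := q) (q := p) (r := r)
      (hD.aestronglyMeasurable.comp_measurePreserving hD')
      (hg.aestronglyMeasurable.comp_measurePreserving hg'))
    rw [← eLpNorm_enorm ((g ∘ fun x => x - z.1) • D ∘ fun x => x - z.2 • z.1)]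
    simp only [Pi.smul_apply', Function.comp_apply, enorm_smul]
  · rw [← univ_prod_univ, Measure.prod_prod]

theorem sum_mul_apply_e {d : ℕ} (L : Euc d →L[ℝ] ℝ) (v : Euc d) :
    ∑ i, v i * L (e d i) = L v := by
  have hv : v = ∑ i, v i • e d i := by
    simpa [e] using ((EuclideanSpace.basisFun (Fin d) ℝ).sum_repr v).symm
  conv_rhs => rw [hv]
  simp

/-- The commutator of mollification by `φ` and multiplication by `f`, under the divergence. -/
theorem mollifier_commutator_eq {d : ℕ} {φ : Euc d → ℝ} (hφ : ContDiff ℝ 1 φ)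
    (hφc : HasCompactSupport φ) {f : Euc d → Euc d} (hf : Differentiable ℝ f)
    {g : Euc d → ℝ} (hg : LocallyIntegrable g) (x : Euc d) :
    (∫ y, ∑ i, (g y * f y i) * fderiv ℝ φ (x - y) (e d i))
        - ∑ i, fderiv ℝ (fun z => (∫ y, φ (z - y) • g y) * f z i) x (e d i)
      = (∫ y, g y * fderiv ℝ φ (x - y) (f y - f x))
        - (∫ y, φ (x - y) * g y) * ∑ i, fderiv ℝ f x (e d i) i := by
  have hDφ : Continuous (fderiv ℝ φ) := hφ.continuous_fderiv one_ne_zero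
  have hDφc : HasCompactSupport fun y => fderiv ℝ φ (x - y) :=
    (hφc.fderiv ℝ).comp_homeomorph (Homeomorph.subLeft x)
  have hint : ∀ {u : Euc d → Euc d}, Continuous u →
      Integrable fun y => g y * fderiv ℝ φ (x - y) (u y) := fun {u} hu => by
    refine hg.integrable_smul_right_of_hasCompactSupport
      (g := fun y => fderiv ℝ φ (x - y) (u y)) (by fun_prop) (hDφc.mono fun y hy => ?_)
    contrapose! hy
    simp_all
  have hconv : HasFDerivAt (fun z => ∫ y, φ (z - y) • g y)
      (∫ y, g y • fderiv ℝ φ (x - y)) x := by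
    have h := hφc.hasFDerivAt_convolution_right (ContinuousLinearMap.mul ℝ ℝ) hg hφ x
    simp only [convolution_def] at h
    convert! h using 1
    · funext z
      exact integral_congr_ae (.of_forall fun y => by simp [mul_comm])
  have hconv_apply : ∀ v, (∫ y, g y • fderiv ℝ φ (x - y)) v
      = ∫ y, g y * fderiv ℝ φ (x - y) v := fun v => by
    rw [ContinuousLinearMap.integral_apply]
    · rfl
    · exact hg.integrable_smul_right_of_hasCompactSupport (by fun_prop) hDφc
  have hprod : ∀ i, fderiv ℝ (fun z => (∫ y, φ (z - y) • g y) * f z i) x (e d i)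
      = (∫ y, φ (x - y) * g y) * fderiv ℝ f x (e d i) i
        + f x i * (∫ y, g y • fderiv ℝ φ (x - y)) (e d i) := fun i => by
    have hfi : HasFDerivAt (fun z => f z i) ((EuclideanSpace.proj i).comp (fderiv ℝ f x)) x :=
      (EuclideanSpace.proj i : Euc d →L[ℝ] ℝ).hasFDerivAt.comp x
        (hf x).hasFDerivAt
    have hmul : HasFDerivAt (fun z => (∫ y, φ (z - y) • g y) * f z i) _ x := hconv.mul hfi
    rw [hmul.fderiv]
    simp
  simp_rw [hprod, Finset.sum_add_distrib, sum_mul_apply_e, ← Finset.mul_sum, hconv_apply,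
    mul_assoc, ← Finset.mul_sum, sum_mul_apply_e, map_sub, mul_sub]
  rw [integral_sub (hint hf.continuous) (hint continuous_const)]
  ring

/-- Pointwise control of the mollification commutator by averages of `|g|` and `‖∇f‖`. -/
theorem enorm_mollifier_commutator_le {d : ℕ} {φ : Euc d → ℝ} (hφ : ContDiff ℝ 1 φ) {ρ : ℝ}
    (hρ : ∀ w ∉ closedBall (0 : Euc d) ρ, φ w = 0)
    (hDρ : ∀ w ∉ closedBall (0 : Euc d) ρ, fderiv ℝ φ w = 0) {A B : NNReal}
    (hA : ∀ w, ‖fderiv ℝ φ w‖ₑ * ‖w‖ₑ ≤ A) (hB : ∀ w, ‖φ w‖ₑ ≤ B) {f : Euc d → Euc d}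
    (hf : Differentiable ℝ f) {g : Euc d → ℝ} (hg : LocallyIntegrable g) (x : Euc d) :
    ‖(∫ y, ∑ i, (g y * f y i) * fderiv ℝ φ (x - y) (e d i))
        - ∑ i, fderiv ℝ (fun z => (∫ y, φ (z - y) • g y) * f z i) x (e d i)‖ₑ
      ≤ (A + d * B : NNReal) * ∫⁻ w in closedBall 0 ρ, ‖g (x - w)‖ₑ *
          ∫⁻ t, ‖fderiv ℝ f (x - t • w)‖ₑ ∂(volume.restrict (Icc (0 : ℝ) 1) + Measure.dirac 0) := by
  set τ : Measure ℝ := volume.restrict (Icc (0 : ℝ) 1) + Measure.dirac 0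
  set I := ∫⁻ w in closedBall 0 ρ, ‖g (x - w)‖ₑ * ∫⁻ t, ‖fderiv ℝ f (x - t • w)‖ₑ ∂τ
  have hφc : HasCompactSupport φ := HasCompactSupport.intro (isCompact_closedBall 0 ρ) hρ
  have bound : ∀ {c : NNReal} {H : Euc d → ℝ≥0∞},
      (∀ w ∉ closedBall (0 : Euc d) ρ, H w = 0) →
      (∀ w, H w ≤ c * (‖g (x - w)‖ₑ * ∫⁻ t, ‖fderiv ℝ f (x - t • w)‖ₑ ∂τ)) →
      ∫⁻ w, H w ≤ c * I := fun {c H} h0 hH => by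
    rw [← lintegral_const_mul' _ _ ENNReal.coe_ne_top, ← lintegral_indicator measurableSet_closedBall]
    refine lintegral_mono fun w => ?_
    by_cases hw : w ∈ closedBall (0 : Euc d) ρ
    · simpa [hw] using hH w
    · simp [hw, h0 w hw]
  have hτ : ∀ w : Euc d, ‖f (x - w) - f x‖ₑ ≤ ‖w‖ₑ * ∫⁻ t, ‖fderiv ℝ f (x - t • w)‖ₑ ∂τ :=
    fun w => (enorm_sub_le_lintegral_fderiv hf x w).trans <| by
      gcongr
      exact Measure.le_add_right le_rfl
  have hτ0 : ∀ w : Euc d, ‖fderiv ℝ f x‖ₑ ≤ ∫⁻ t, ‖fderiv ℝ f (x - t • w)‖ₑ ∂τ := fun w => by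
    calc ‖fderiv ℝ f x‖ₑ = ∫⁻ t, ‖fderiv ℝ f (x - t • w)‖ₑ ∂(Measure.dirac (0 : ℝ)) := by
          simp [lintegral_dirac]
      _ ≤ _ := lintegral_mono' (Measure.le_add_left le_rfl) le_rfl
  have hdiv : ‖∑ i, fderiv ℝ f x (e d i) i‖ₑ ≤ d * ‖fderiv ℝ f x‖ₑ := by
    refine (enorm_sum_le _ _).trans ?_
    calc ∑ i, ‖fderiv ℝ f x (e d i) i‖ₑ ≤ ∑ _ : Fin d, ‖fderiv ℝ f x‖ₑ := by
          refine Finset.sum_le_sum fun i _ => ?_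
          rw [enorm_le_iff_norm_le]
          refine (PiLp.norm_apply_le _ i).trans (((fderiv ℝ f x).le_opNorm _).trans ?_)
          simp [e]
      _ = d * ‖fderiv ℝ f x‖ₑ := by simp
  rw [mollifier_commutator_eq hφ hφc hf hg, ENNReal.coe_add, ENNReal.coe_mul, ENNReal.coe_natCast, add_mul]
  refine enorm_sub_le.trans (add_le_add ?_ ?_)
  · refine (enorm_integral_le_lintegral_enorm _).trans ?_
    rw [← lintegral_sub_left_eq_self _ x]
    refine bound (fun w hw => by simp [hDρ w hw]) fun w => ?_
    rw [sub_sub_cancel, enorm_mul]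
    calc ‖g (x - w)‖ₑ * ‖fderiv ℝ φ w (f (x - w) - f x)‖ₑ
        ≤ ‖g (x - w)‖ₑ * (‖fderiv ℝ φ w‖ₑ * (‖w‖ₑ *
            ∫⁻ t, ‖fderiv ℝ f (x - t • w)‖ₑ ∂τ)) := by
          gcongr
          exact ((fderiv ℝ φ w).le_opENorm _).trans (by gcongr; exact hτ w)
      _ = (‖fderiv ℝ φ w‖ₑ * ‖w‖ₑ) *
            (‖g (x - w)‖ₑ * ∫⁻ t, ‖fderiv ℝ f (x - t • w)‖ₑ ∂τ) := by ring
      _ ≤ _ := by gcongr; exact hA w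
  · rw [enorm_mul]
    calc ‖∫ y, φ (x - y) * g y‖ₑ * ‖∑ i, fderiv ℝ f x (e d i) i‖ₑ
        ≤ (∫⁻ y, ‖φ (x - y) * g y‖ₑ) * (d * ‖fderiv ℝ f x‖ₑ) := by
          gcongr
          exact enorm_integral_le_lintegral_enorm _
      _ = (∫⁻ w, ‖φ w * g (x - w)‖ₑ * ‖fderiv ℝ f x‖ₑ) * d := by
          rw [lintegral_mul_const' _ _ enorm_ne_top, ← lintegral_sub_left_eq_self _ x]
          simp only [sub_sub_cancel]
          ring
      _ ≤ (B * I) * d := by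
          gcongr
          refine bound (fun w hw => by simp [hρ w hw]) fun w => ?_
          rw [enorm_mul, mul_assoc]
          gcongr
          exacts [hB w, hτ0 w]
      _ = d * B * I := by ring

theorem IsStdMollifier.hasCompactSupport {d : ℕ} {η : Euc d → ℝ} (hη : IsStdMollifier η) :
    HasCompactSupport η :=
  (isCompact_closedBall 0 1).of_isClosed_subset (isClosed_tsupport η) hη.2.2.2

theorem contDiff_mollScaled {d : ℕ} {η : Euc d → ℝ} (hη : ContDiff ℝ (⊤ : ℕ∞) η) (ε : ℝ) :
    ContDiff ℝ (⊤ : ℕ∞) (mollScaled η ε) :=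
  contDiff_const.mul (hη.comp (contDiff_const_smul ε⁻¹))

theorem fderiv_mollScaled {d : ℕ} {η : Euc d → ℝ} (hη : Differentiable ℝ η) (ε : ℝ) (x : Euc d) :
    fderiv ℝ (mollScaled η ε) x = ((ε ^ d)⁻¹ * ε⁻¹) • fderiv ℝ η (ε⁻¹ • x) := by
  have h : HasFDerivAt (mollScaled η ε) _ x :=
    ((hη (ε⁻¹ • x)).hasFDerivAt.comp x ((hasFDerivAt_id x).const_smul ε⁻¹)).const_mul (ε ^ d)⁻¹
  rw [h.fderiv]
  ext v
  simp [mul_assoc]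

theorem inv_smul_notMem_tsupport {d : ℕ} {η : Euc d → ℝ} (hη : tsupport η ⊆ closedBall 0 1)
    {ε : ℝ} (hε : 0 < ε) {w : Euc d} (hw : w ∉ closedBall 0 ε) : ε⁻¹ • w ∉ tsupport η := by
  contrapose! hw
  have h := hη hw
  rw [mem_closedBall_zero_iff, norm_smul, norm_inv, Real.norm_of_nonneg hε.le,
    inv_mul_le_one₀ hε] at h
  simpa using h

/-- **Lions' commutator estimate** (Lemma 2.1, estimate): for `f ∈ W^{1,p}(ℝ^d)`,
`g ∈ L^q(ℝ^d)`, `1/p + 1/q ≤ 1`, `1/r = 1/p + 1/q`,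
`‖div(fg) * η_ε − div(f (g * η_ε))‖_{L^r} ≤ C ‖f‖_{W^{1,p}} ‖g‖_{L^q}`,
with `C` independent of `ε`, `f`, `g`.  Here `div(fg) * η_ε` is the mollified
distributional divergence, computed by putting the derivative on `η_ε`. -/
theorem lions_commutator_bound {d : ℕ} (hd : 0 < d)
    (η : Euc d → ℝ) (hη : IsStdMollifier η)
    (p q r : ℝ≥0∞) (hp : 1 ≤ p) (hq : 1 ≤ q)
    (hpq : p⁻¹ + q⁻¹ ≤ 1) (hr : r⁻¹ = p⁻¹ + q⁻¹) :
    ∃ C : ℝ, 0 ≤ C ∧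
      ∀ (f : Euc d → Euc d) (g : Euc d → ℝ),
        Differentiable ℝ f →
        eLpNorm f p volume < ⊤ →
        eLpNorm (fun x => fderiv ℝ f x) p volume < ⊤ →
        AEStronglyMeasurable g volume → eLpNorm g q volume < ⊤ →
        ∀ ε : ℝ, 0 < ε →
          eLpNorm (fun x =>
              (∫ y, ∑ i, (g y * f y i) * fderiv ℝ (mollScaled η ε) (x - y) (e d i))
                - ∑ i, fderiv ℝ (fun z => moll η ε g z * f z i) x (e d i)) r volume
            ≤ ENNReal.ofReal C
                * (eLpNorm f p volume + eLpNorm (fun x => fderiv ℝ f x) p volume)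
                * eLpNorm g q volume := by
  obtain ⟨N, hN⟩ := hη.hasCompactSupport.exists_bound_of_continuous hη.1.continuous
  obtain ⟨M, hM⟩ := (hη.hasCompactSupport.fderiv ℝ).exists_bound_of_continuous
    (hη.1.continuous_fderiv (by simp))
  have hN0 : 0 ≤ N := (norm_nonneg _).trans (hN 0)
  have hM0 : 0 ≤ M := (norm_nonneg _).trans (hM 0)
  have hηdiff : Differentiable ℝ η := hη.1.differentiable (by simp)
  have hr1 : 1 ≤ r := by rwa [← hr, ENNReal.inv_le_one] at hpq
  set V := (volume (closedBall (0 : Euc d) 1)).toReal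
  have hVol : volume (closedBall (0 : Euc d) 1) = ENNReal.ofReal V :=
    (ENNReal.ofReal_toReal measure_closedBall_lt_top.ne).symm
  refine ⟨(M + d * N) * V * 2, by positivity, fun f g hf hfp hDf hg hgq ε hε => ?_⟩
  set g' := hg.mk g
  have hgg' : g =ᵐ[volume] g' := hg.ae_eq_mk
  have hg' : StronglyMeasurable g' := hg.stronglyMeasurable_mk
  have hg'loc : LocallyIntegrable g' :=
    MemLp.locallyIntegrable ⟨hg'.aestronglyMeasurable, by rwa [← eLpNorm_congr_ae hgg']⟩ hq
  have hφ := contDiff_mollScaled hη.1 ε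
  set A : NNReal := Real.toNNReal ((ε ^ d)⁻¹ * M) with hA
  set B : NNReal := Real.toNNReal ((ε ^ d)⁻¹ * N) with hB
  have hDφ : ∀ w ∉ closedBall (0 : Euc d) ε, fderiv ℝ (mollScaled η ε) w = 0 := fun w hw => by
    rw [fderiv_mollScaled hηdiff, fderiv_of_notMem_tsupport
      (𝕜 := ℝ) (inv_smul_notMem_tsupport hη.2.2.2 hε hw), smul_zero]
  have hpt := enorm_mollifier_commutator_le (hφ.of_le (by simp)) (ρ := ε) (A := A) (B := B)
    (fun w hw => by
      simp [mollScaled, image_eq_zero_of_notMem_tsupport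
        (inv_smul_notMem_tsupport hη.2.2.2 hε hw)])
    hDφ
    (fun w => by
      by_cases hw : w ∈ closedBall (0 : Euc d) ε
      · rw [fderiv_mollScaled hηdiff, ← enorm_norm (_ • _), ← enorm_norm w, ← enorm_mul,
          Real.enorm_of_nonneg (by positivity), hA]
        refine ENNReal.ofReal_le_ofReal ?_
        rw [norm_smul, Real.norm_of_nonneg (by positivity)]
        calc (ε ^ d)⁻¹ * ε⁻¹ * ‖fderiv ℝ η (ε⁻¹ • w)‖ * ‖w‖
            ≤ (ε ^ d)⁻¹ * ε⁻¹ * M * ε := by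
              gcongr
              exacts [hM _, by simpa using hw]
          _ = (ε ^ d)⁻¹ * M := by field_simp
      · rw [hDφ w hw, ← enorm_norm (0 : Euc d →L[ℝ] ℝ)]
        simp)
    (fun w => by
      rw [mollScaled, ← enorm_norm, Real.enorm_of_nonneg (by positivity), hB]
      refine ENNReal.ofReal_le_ofReal ?_
      rw [norm_mul, Real.norm_of_nonneg (by positivity)]
      gcongr
      exact hN _)
    hf hg'loc
  have hmoll : moll η ε g = moll η ε g' := funext fun x =>
    integral_congr_ae (hgg'.mono fun y hy => by simp only [hy])
  have hdivint : ∀ x, (∫ y, ∑ i, (g y * f y i) * fderiv ℝ (mollScaled η ε) (x - y) (e d i))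
      = ∫ y, ∑ i, (g' y * f y i) * fderiv ℝ (mollScaled η ε) (x - y) (e d i) := fun x =>
    integral_congr_ae (hgg'.mono fun y hy => by simp only [hy])
  simp_rw [hdivint, hmoll]
  have hconst : ((A + d * B : NNReal) : ℝ≥0∞) * volume (closedBall (0 : Euc d) ε) * 2
      = ENNReal.ofReal ((M + d * N) * V * 2) := by
    have hAB : ((A + d * B : NNReal) : ℝ≥0∞) = ENNReal.ofReal ((ε ^ d)⁻¹ * (M + d * N)) := by
      rw [ENNReal.ofReal, hA, hB, ← Real.toNNReal_natCast d, ← Real.toNNReal_mul (by positivity),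
        ← Real.toNNReal_add (by positivity) (by positivity)]
      congr 2
      ring
    rw [hAB, Measure.addHaar_closedBall' _ _ hε.le, hVol, finrank_euclideanSpace_fin,
      ← ENNReal.ofReal_ofNat 2, ← ENNReal.ofReal_mul (by positivity),
      ← ENNReal.ofReal_mul (by positivity), ← ENNReal.ofReal_mul (by positivity)]
    congr 1
    field_simp
  have hD : StronglyMeasurable (fderiv ℝ f) := (measurable_fderiv ℝ f).stronglyMeasurable
  have hball : IsFiniteMeasure (volume.restrict (closedBall (0 : Euc d) ε)) :=
    ⟨by simpa using measure_closedBall_lt_top⟩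
  have hmain := eLpNorm_lintegral_translate_mul_le (ν := (volume : Measure (Euc d))) hr1 hr hg' hD
    (volume.restrict (closedBall (0 : Euc d) ε))
    (volume.restrict (Icc (0 : ℝ) 1) + Measure.dirac 0)
  calc _ ≤ ((A + d * B : NNReal) : ℝ≥0∞) * eLpNorm (fun x =>
          ∫⁻ w in closedBall 0 ε, ‖g' (x - w)‖ₑ * ∫⁻ t, ‖fderiv ℝ f (x - t • w)‖ₑ
            ∂(volume.restrict (Icc (0 : ℝ) 1) + Measure.dirac 0)) r volume :=
        eLpNorm_le_mul_eLpNorm_of_ae_le_mul' (.of_forall hpt) r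
    _ ≤ _ := mul_le_mul_right hmain _
    _ = ENNReal.ofReal ((M + d * N) * V * 2) * eLpNorm (fderiv ℝ f) p volume
          * eLpNorm g q volume := by
      rw [← hconst, eLpNorm_congr_ae hgg']
      simp only [Measure.restrict_apply_univ, Measure.add_apply, Real.volume_Icc, measure_univ,
        sub_zero, ENNReal.ofReal_one, one_add_one_eq_two]
      ring
    _ ≤ _ := by
      gcongr
      exact le_add_self
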